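/- For every positive integer n, ζ(2n)·ζ(2n+1) = (-1)^{n+1} ∫_{(0,1)^n} (∏_{i=1}^{n} log(x_i)/x_i) · log(φ(∏_{i=1}^{n} x_i)) dx_1 ⋯ dx_n, where φ is Euler's function φ(q) = ∏_{m=1}^{∞} (1 - q^m). -/

import Mathlib

open MeasureTheory Real

/-- The Riemann zeta function at integer arguments `s ≥ 2`, as the convergent
series `∑_{k=1}^∞ 1/k^s`. -/
noncomputable def zetaVal (s : ℕ) : ℝ := ∑' k : ℕ, 1 / ((k : ℝ) + 1) ^ s

/-- Euler's function `φ(q) = ∏_{m=1}^∞ (1 - q^m)`. -/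
noncomputable def eulerPhi (q : ℝ) : ℝ := ∏' m : ℕ, (1 - q ^ (m + 1))

lemma intervalIntegrable_log_mul_pow (a b : ℝ) (N : ℕ) :
    IntervalIntegrable (fun t : ℝ => Real.log t * t ^ N) volume a b :=
  (intervalIntegral.intervalIntegrable_log' (a := a) (b := b)).mul_continuousOn
    (continuous_pow N).continuousOn

lemma integral_log_mul_pow (N : ℕ) :
    ∫ t in (0 : ℝ)..1, Real.log t * t ^ N = -(1 / ((N : ℝ) + 1) ^ 2) := by
  have hN : (N : ℝ) + 1 ≠ 0 := by positivity
  rw [intervalIntegral.integral_eq_sub_of_hasDerivAt_of_le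
    (f := fun t : ℝ => t ^ N * (t * Real.log t) / (N + 1) - t ^ (N + 1) / (N + 1) ^ 2)
    zero_le_one]
  · simp
  · have := Real.continuous_mul_log
    exact Continuous.continuousOn (by fun_prop)
  · intro t ht
    have ht0 : t ≠ 0 := ht.1.ne'
    have h := (((hasDerivAt_pow (N + 1) t).mul (Real.hasDerivAt_log ht0)).div_const
      ((N : ℝ) + 1)).sub ((hasDerivAt_pow (N + 1) t).div_const (((N : ℝ) + 1) ^ 2))
    convert h using 1
    · ext y
      simp only [Pi.sub_apply, Pi.mul_apply]
      ring
    · simp only [Nat.add_sub_cancel, Nat.cast_add, Nat.cast_one]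
      field_simp
      ring
  · exact intervalIntegrable_log_mul_pow 0 1 N

lemma log_div_mul_pow_succ (t : ℝ) (N : ℕ) :
    Real.log t / t * t ^ (N + 1) = Real.log t * t ^ N := by
  rcases eq_or_ne t 0 with rfl | ht
  · simp
  · field_simp
    ring

lemma integrable_log_div_mul_pow {N : ℕ} (hN : 0 < N) :
    Integrable (fun t : ℝ => Real.log t / t * t ^ N) (volume.restrict (Set.Ioo 0 1)) := by
  obtain ⟨N, rfl⟩ := Nat.exists_eq_add_one.mpr hN
  simp_rw [log_div_mul_pow_succ]
  exact (intervalIntegrable_iff_integrableOn_Ioo_of_le zero_le_one).mp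
    (intervalIntegrable_log_mul_pow 0 1 N)

lemma integral_log_div_mul_pow {N : ℕ} (hN : 0 < N) :
    ∫ t in Set.Ioo (0 : ℝ) 1, Real.log t / t * t ^ N = -(1 / (N : ℝ) ^ 2) := by
  obtain ⟨N, rfl⟩ := Nat.exists_eq_add_one.mpr hN
  simp_rw [log_div_mul_pow_succ]
  rw [← integral_Ioc_eq_integral_Ioo, ← intervalIntegral.integral_of_le zero_le_one,
    integral_log_mul_pow]
  push_cast
  rfl

lemma integral_norm_log_div_mul_pow {N : ℕ} (hN : 0 < N) :
    ∫ t in Set.Ioo (0 : ℝ) 1, ‖Real.log t / t * t ^ N‖ = 1 / (N : ℝ) ^ 2 := by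
  rw [← neg_neg (1 / (N : ℝ) ^ 2), ← integral_log_div_mul_pow hN, ← integral_neg]
  refine setIntegral_congr_fun measurableSet_Ioo fun t ht => ?_
  refine Real.norm_of_nonpos (mul_nonpos_of_nonpos_of_nonneg ?_ (pow_nonneg ht.1.le _))
  exact div_nonpos_of_nonpos_of_nonneg (Real.log_nonpos ht.1.le ht.2.le) ht.1.le

lemma hasSum_log_eulerPhi {q : ℝ} (hq0 : 0 ≤ q) (hq1 : q < 1) :
    HasSum (fun p : ℕ × ℕ => q ^ ((p.1 + 1) * (p.2 + 1)) / ((p.2 : ℝ) + 1))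
      (-Real.log (eulerPhi q)) := by
  have hlt (m : ℕ) : q ^ (m + 1) < 1 := pow_lt_one₀ hq0 hq1 m.succ_ne_zero
  have hrow (m : ℕ) : HasSum (fun k : ℕ => q ^ ((m + 1) * (k + 1)) / ((k : ℝ) + 1))
      (-Real.log (1 - q ^ (m + 1))) := by
    simp_rw [pow_mul]
    refine Real.hasSum_pow_div_log_of_abs_lt_one ?_
    rw [abs_of_nonneg (by positivity)]
    exact hlt m
  have hlog : Summable fun m : ℕ => Real.log (1 - q ^ (m + 1)) := by
    have h : Summable fun m : ℕ => -q ^ (m + 1) :=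
      ((summable_nat_add_iff 1).mpr (summable_geometric_of_lt_one hq0 hq1)).neg
    simpa only [sub_eq_add_neg] using Real.summable_log_one_add_of_summable h
  have hphi : Real.log (eulerPhi q) = ∑' m : ℕ, Real.log (1 - q ^ (m + 1)) := by
    rw [eulerPhi, ← Real.rexp_tsum_eq_tprod (fun m => sub_pos.mpr (hlt m)) hlog, Real.log_exp]
  have hsum : Summable fun p : ℕ × ℕ => q ^ ((p.1 + 1) * (p.2 + 1)) / ((p.2 : ℝ) + 1) := by
    refine (summable_prod_of_nonneg fun p => by positivity).mpr
      ⟨fun m => (hrow m).summable, ?_⟩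
    simp_rw [fun m => (hrow m).tsum_eq]
    exact hlog.neg
  rw [hphi, ← tsum_neg, ← funext fun m => (hrow m).tsum_eq, ← hsum.tsum_prod]
  exact hsum.hasSum

lemma summable_one_div_nat_add_one_pow {s : ℕ} (hs : 1 < s) :
    Summable fun k : ℕ => 1 / ((k : ℝ) + 1) ^ s := by
  have h := (summable_nat_add_iff 1).mpr (Real.summable_one_div_nat_pow.mpr hs)
  simpa using h

lemma hasSum_zetaVal_mul_zetaVal {n : ℕ} (hn : 0 < n) :
    HasSum (fun p : ℕ × ℕ =>
        (1 / (((p.1 + 1) * (p.2 + 1) : ℕ) : ℝ) ^ 2) ^ n / ((p.2 : ℝ) + 1))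
      (zetaVal (2 * n) * zetaVal (2 * n + 1)) := by
  have h1 := summable_one_div_nat_add_one_pow (s := 2 * n) (by omega)
  have h2 := summable_one_div_nat_add_one_pow (s := 2 * n + 1) (by omega)
  have h := h1.hasSum.mul h2.hasSum
    (h1.mul_of_nonneg h2 (fun k => by positivity) (fun k => by positivity))
  refine h.congr_fun fun p => ?_
  rw [one_div_pow, ← pow_mul, Nat.cast_mul, mul_pow, pow_succ ((p.2 : ℝ) + 1)]
  push_cast
  field_simp

theorem zeta_even_mul_zeta_odd_integral (n : ℕ) (hn : 0 < n) :
    zetaVal (2 * n) * zetaVal (2 * n + 1) =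
      (-1 : ℝ) ^ (n + 1) *
        ∫ x in Set.univ.pi (fun _ : Fin n => Set.Ioo (0 : ℝ) 1),
          (∏ i, Real.log (x i) / x i) * Real.log (eulerPhi (∏ i, x i)) := by
  have hmeas : (volume : Measure (Fin n → ℝ)).restrict
      (Set.univ.pi fun _ : Fin n => Set.Ioo (0 : ℝ) 1) =
      Measure.pi fun _ : Fin n => volume.restrict (Set.Ioo (0 : ℝ) 1) := by
    rw [volume_pi, Measure.restrict_pi_pi]
  have hN (p : ℕ × ℕ) : 0 < (p.1 + 1) * (p.2 + 1) := by positivity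
  set F : ℕ × ℕ → (Fin n → ℝ) → ℝ := fun p x =>
    (∏ i, Real.log (x i) / x i * x i ^ ((p.1 + 1) * (p.2 + 1))) / ((p.2 : ℝ) + 1) with hF
  have hpt : ∀ x ∈ Set.univ.pi (fun _ : Fin n => Set.Ioo (0 : ℝ) 1),
      (∏ i, Real.log (x i) / x i) * Real.log (eulerPhi (∏ i, x i)) = -∑' p, F p x := by
    intro x hx
    have hx' (i : Fin n) : 0 < x i ∧ x i < 1 := hx i (Set.mem_univ i)
    have hq0 : 0 ≤ ∏ i, x i := Finset.prod_nonneg fun i _ => (hx' i).1.le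
    have hq1 : ∏ i, x i < 1 := by
      have : Nonempty (Fin n) := ⟨⟨0, hn⟩⟩
      simpa using Finset.prod_lt_prod_of_nonempty (fun i _ => (hx' i).1)
        (fun i _ => (hx' i).2) Finset.univ_nonempty
    have h := ((hasSum_log_eulerPhi hq0 hq1).mul_left (∏ i, Real.log (x i) / x i)).tsum_eq
    simp_rw [hF, Finset.prod_mul_distrib, Finset.prod_pow, mul_div_assoc]
    rw [h]
    ring
  rw [setIntegral_congr_fun (MeasurableSet.univ_pi fun _ => measurableSet_Ioo) hpt, hmeas,
    integral_neg]
  have hint (p : ℕ × ℕ) : Integrable (F p)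
      (Measure.pi fun _ : Fin n => volume.restrict (Set.Ioo (0 : ℝ) 1)) :=
    (Integrable.fintype_prod fun _ => integrable_log_div_mul_pow (hN p)).div_const _
  have hval (p : ℕ × ℕ) :
      ∫ x, F p x ∂(Measure.pi fun _ : Fin n => volume.restrict (Set.Ioo (0 : ℝ) 1)) =
        (-1) ^ n * ((1 / (((p.1 + 1) * (p.2 + 1) : ℕ) : ℝ) ^ 2) ^ n / ((p.2 : ℝ) + 1)) := by
    rw [hF, integral_div, integral_fintype_prod_eq_pow
      (fun t : ℝ => Real.log t / t * t ^ ((p.1 + 1) * (p.2 + 1))),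
      integral_log_div_mul_pow (hN p), Fintype.card_fin, neg_pow, mul_div_assoc]
  have hnorm (p : ℕ × ℕ) :
      ∫ x, ‖F p x‖ ∂(Measure.pi fun _ : Fin n => volume.restrict (Set.Ioo (0 : ℝ) 1)) =
        (1 / (((p.1 + 1) * (p.2 + 1) : ℕ) : ℝ) ^ 2) ^ n / ((p.2 : ℝ) + 1) := by
    have hk : ‖(p.2 : ℝ) + 1‖ = (p.2 : ℝ) + 1 := Real.norm_of_nonneg (by positivity)
    simp_rw [hF, norm_div, norm_prod, hk]
    rw [integral_div, integral_fintype_prod_eq_pow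
      (fun t : ℝ => ‖Real.log t / t * t ^ ((p.1 + 1) * (p.2 + 1))‖),
      integral_norm_log_div_mul_pow (hN p), Fintype.card_fin]
  have hz := hasSum_zetaVal_mul_zetaVal hn
  have hsum := hasSum_integral_of_summable_integral_norm hint
    (hz.summable.congr fun p => (hnorm p).symm)
  simp_rw [hval] at hsum
  rw [show (∫ x, ∑' p, F p x ∂(Measure.pi fun _ : Fin n => volume.restrict (Set.Ioo (0 : ℝ) 1)))
    = _ from hsum.unique (hz.mul_left _), pow_succ]
  have h1 : ((-1 : ℝ) ^ n) * (-1) ^ n = 1 := by rw [← mul_pow]; simp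
  linear_combination (-(zetaVal (2 * n) * zetaVal (2 * n + 1))) * h1
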